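/- (Lemma 4.3, capacity upper bound in dimensions n ≥ 3.) Let n ≥ 3 and assume the Monge-Ampère measure μ of u is doubling with respect to the center of mass on the sections of u with constants α, β. Then there is a constant C > 0 depending only on n, α, β such that: for every open set V ⊂⊂ Ω, every x₀ ∈ V, and every t > 0 with S_u(x₀, 2t) ⊂⊂ V, one has cap_{L_u}(cl(S_u(x₀, t)), V) ≤ C · μ(S_u(x₀, t)) · t^{-1}. -/

import Mathlib

open MeasureTheory

noncomputable section

/-- Euclidean space `ℝⁿ`. -/
abbrev E (n : ℕ) := EuclideanSpace ℝ (Fin n)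

/-- First partial derivative `∂_i f (x)`. -/
noncomputable def pd {n : ℕ} (f : E n → ℝ) (x : E n) (i : Fin n) : ℝ :=
  fderiv ℝ f x (EuclideanSpace.single i 1)

/-- Second partial derivative `∂_{ij} f (x)`. -/
noncomputable def pd2 {n : ℕ} (f : E n → ℝ) (x : E n) (i j : Fin n) : ℝ :=
  fderiv ℝ (fun y => fderiv ℝ f y (EuclideanSpace.single j 1)) x (EuclideanSpace.single i 1)

/-- Hessian matrix `D²f(x)`. -/
noncomputable def Hess {n : ℕ} (f : E n → ℝ) (x : E n) : Matrix (Fin n) (Fin n) ℝ :=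
  Matrix.of fun i j => pd2 f x i j

/-- The cofactor matrix `U = (det D²u)(D²u)⁻¹` of the Hessian of `u`,
realized as the adjugate. -/
noncomputable def cofU {n : ℕ} (u : E n → ℝ) (x : E n) : Matrix (Fin n) (Fin n) ℝ :=
  (Hess u x).adjugate

/-- Section of the convex function `u`:
`S_u(x₀,t) = {x ∈ cl Ω : u x < u x₀ + ∇u(x₀)·(x - x₀) + t}`. -/
def MASection {n : ℕ} (Ω : Set (E n)) (u : E n → ℝ) (x₀ : E n) (t : ℝ) : Set (E n) :=
  {x ∈ closure Ω | u x < u x₀ + fderiv ℝ u x₀ (x - x₀) + t}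

/-- `A ⊂⊂ B`: the closure of `A` is a compact subset of `B`. -/
def CptIn {n : ℕ} (A B : Set (E n)) : Prop :=
  IsCompact (closure A) ∧ closure A ⊆ B

/-- Uniform convexity of a domain: balls of radius proportional to `‖x - y‖²`
centered at midpoints of points of the closure stay in the closure. -/
def UnifConvex {n : ℕ} (Ω : Set (E n)) : Prop :=
  ∃ δ > 0, ∀ x ∈ closure Ω, ∀ y ∈ closure Ω,
    Metric.closedBall (midpoint ℝ x y) (δ * ‖x - y‖ ^ 2) ⊆ closure Ω

/-- Standing assumptions: `Ω` is a bounded, open, nonempty, uniformly convex domain and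
`u` is a smooth convex function on `cl Ω` vanishing on `∂Ω`. -/
def MASetup {n : ℕ} (Ω : Set (E n)) (u : E n → ℝ) : Prop :=
  IsOpen Ω ∧ Bornology.IsBounded Ω ∧ Ω.Nonempty ∧ UnifConvex Ω ∧
  ContDiffOn ℝ (⊤ : ℕ∞) u (closure Ω) ∧ ConvexOn ℝ (closure Ω) u ∧
  ∀ x ∈ frontier Ω, u x = 0

/-- `λ ≤ det D²u ≤ Λ` in `Ω`. -/
def DetBounds {n : ℕ} (Ω : Set (E n)) (u : E n → ℝ) (lam Lam : ℝ) : Prop :=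
  ∀ x ∈ Ω, lam ≤ (Hess u x).det ∧ (Hess u x).det ≤ Lam

/-- The Monge-Ampère measure of `u`: `μ(A) = ∫_A det D²u`. -/
noncomputable def maMeasure {n : ℕ} (u : E n → ℝ) (A : Set (E n)) : ℝ :=
  ∫ x in A, (Hess u x).det

/-- Center of mass of a set. -/
noncomputable def centerOfMass {n : ℕ} (S : Set (E n)) : E n :=
  (volume S).toReal⁻¹ • ∫ x in S, x

/-- The `α`-dilation of `S` with respect to its center of mass. -/
def dilateCM {n : ℕ} (α : ℝ) (S : Set (E n)) : Set (E n) :=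
  (fun x => centerOfMass S + α • (x - centerOfMass S)) '' S

/-- The Monge-Ampère measure of `u` is doubling with respect to the center of mass
on the sections of `u`, with constants `0 < α < 1 < β`. -/
def DoublingCM {n : ℕ} (Ω : Set (E n)) (u : E n → ℝ) (α β : ℝ) : Prop :=
  0 < α ∧ α < 1 ∧ 1 < β ∧
  ∀ x₀ ∈ Ω, ∀ t : ℝ, 0 < t → CptIn (MASection Ω u x₀ t) Ω →
    maMeasure u (MASection Ω u x₀ t) ≤ β * maMeasure u (dilateCM α (MASection Ω u x₀ (t / 2)))

/-- `g` is a Green's function of the linearized Monge-Ampère operator `L_u` in `V`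
with pole `y`: positive and smooth on `V \ {y}`, `L_u`-harmonic there, vanishing
continuously on `∂V`, and `∫_V g · (L_u φ) = φ(y)` (i.e. `∫_V g · U^{ij}∂_{ij}φ = -φ(y)`)
for all test functions `φ`. -/
def IsGreen {n : ℕ} (u : E n → ℝ) (V : Set (E n)) (y : E n) (g : E n → ℝ) : Prop :=
  (∀ x ∈ V \ {y}, 0 < g x) ∧
  ContDiffOn ℝ (⊤ : ℕ∞) g (V \ {y}) ∧
  (∀ x ∈ V \ {y}, ∑ i, ∑ j, cofU u x i j * pd2 g x i j = 0) ∧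
  ContinuousOn g (closure V \ {y}) ∧
  (∀ x ∈ frontier V, g x = 0) ∧
  ∀ φ : E n → ℝ, ContDiff ℝ (⊤ : ℕ∞) φ → HasCompactSupport φ → tsupport φ ⊆ V →
    (∫ x in V, g x * ∑ i, ∑ j, cofU u x i j * pd2 φ x i j) = -φ y

/-- Capacity of a compact set `K` relative to `V` for the operator `L_u`:
the infimum of `∫_V U^{ij} ∂_iΦ ∂_jΦ` over Lipschitz `Φ` compactly supported in `V`
with `Φ ≥ 1` on `K`. -/
noncomputable def capacity {n : ℕ} (u : E n → ℝ) (K V : Set (E n)) : ℝ :=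
  sInf { e : ℝ | ∃ Φ : E n → ℝ, (∃ L : NNReal, LipschitzWith L Φ) ∧
    HasCompactSupport Φ ∧ tsupport Φ ⊆ V ∧ (∀ x ∈ K, 1 ≤ Φ x) ∧
    e = ∫ x in V, ∑ i, ∑ j, cofU u x i j * pd Φ x i * pd Φ x j }

section Derivatives

variable {n : ℕ}

lemma ContDiffOn.pd_infty {Ω : Set (E n)} {v : E n → ℝ} (hΩ : IsOpen Ω)
    (hv : ContDiffOn ℝ (⊤ : ℕ∞) v Ω) (i : Fin n) :
    ContDiffOn ℝ (⊤ : ℕ∞) (fun x => pd v x i) Ω :=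
  (hv.fderiv_of_isOpen hΩ (by simp)).clm_apply contDiffOn_const

lemma ContDiffOn.pd2_infty {Ω : Set (E n)} {v : E n → ℝ} (hΩ : IsOpen Ω)
    (hv : ContDiffOn ℝ (⊤ : ℕ∞) v Ω) (i j : Fin n) :
    ContDiffOn ℝ (⊤ : ℕ∞) (fun x => pd2 v x i j) Ω :=
  (hv.pd_infty hΩ j).pd_infty hΩ i

lemma pd2_eq_fderiv_fderiv {v : E n → ℝ} {x : E n} (hv : ContDiffAt ℝ 2 v x) (i j : Fin n) :
    pd2 v x i j =
      fderiv ℝ (fderiv ℝ v) x (EuclideanSpace.single i 1) (EuclideanSpace.single j 1) := by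
  have h : DifferentiableAt ℝ (fderiv ℝ v) x :=
    (hv.fderiv_right (m := 1) (by norm_num)).differentiableAt (by simp)
  unfold pd2
  rw [fderiv_clm_apply h (differentiableAt_const _)]
  simp

lemma pd2_comm {v : E n → ℝ} {x : E n} (hv : ContDiffAt ℝ 2 v x) (i j : Fin n) :
    pd2 v x i j = pd2 v x j i := by
  rw [pd2_eq_fderiv_fderiv hv, pd2_eq_fderiv_fderiv hv]
  exact (hv.isSymmSndFDerivAt (by simp)).eq _ _

lemma pd_congr {f g : E n → ℝ} {x : E n} (h : f =ᶠ[nhds x] g) (i : Fin n) :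
    pd f x i = pd g x i := by
  simp only [pd, h.fderiv_eq]

lemma pd_pd2_comm {Ω : Set (E n)} {v : E n → ℝ} (hΩ : IsOpen Ω)
    (hv : ContDiffOn ℝ (⊤ : ℕ∞) v Ω) {x : E n} (hx : x ∈ Ω) (i k l : Fin n) :
    pd (fun y => pd2 v y k l) x i = pd (fun y => pd2 v y k i) x l := by
  have hsymm : ∀ a b : Fin n, (fun y => pd2 v y a b) =ᶠ[nhds x] fun y => pd2 v y b a := by
    intro a b
    filter_upwards [hΩ.mem_nhds hx] with y hy
    exact pd2_comm ((hv.contDiffAt (hΩ.mem_nhds hy)).of_le (by exact_mod_cast ENat.LEInfty.out)) a b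
  rw [pd_congr (hsymm k l), pd_congr (hsymm k i)]
  exact pd2_comm (((hv.pd_infty hΩ k).contDiffAt (hΩ.mem_nhds hx)).of_le
    (by exact_mod_cast ENat.LEInfty.out)) i l

end Derivatives

section Cofactor

variable {n : ℕ}

open Matrix

lemma sum_det_update_update_eq_zero (H : Fin n → Fin n → ℝ) (T : Fin n → Fin n → ℝ)
    (hT : ∀ i l, T i l = T l i) {j k : Fin n} (hjk : j ≠ k) :
    ∑ i, detRowAlternating
      (Function.update (Function.update H j (Pi.single i (1 : ℝ))) k (T i)) = 0 := by
  set a : Fin n → Fin n → ℝ := fun i l => detRowAlternating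
    (Function.update (Function.update H j (Pi.single i (1 : ℝ))) k (Pi.single l (1 : ℝ))) with ha
  have hanti : ∀ i l, a i l = - a l i := by
    intro i l
    simp only [ha]
    rw [← AlternatingMap.map_swap _ _ hjk]
    congr 1
    funext m
    rcases eq_or_ne m j with rfl | hmj
    · simp [hjk]
    rcases eq_or_ne m k with rfl | hmk
    · simp [hjk]
    · simp [Equiv.swap_apply_of_ne_of_ne hmj hmk, hmj, hmk]
  have hexp : ∀ i, detRowAlternating
      (Function.update (Function.update H j (Pi.single i (1 : ℝ))) k (T i))
        = ∑ l, T i l * a i l := by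
    intro i
    conv_lhs => rw [pi_eq_sum_univ' (T i)]
    rw [AlternatingMap.map_update_sum]
    refine Finset.sum_congr rfl fun l _ => ?_
    rw [AlternatingMap.map_update_smul]
    simp [ha, Pi.single]
  simp only [hexp]
  have hneg : ∑ i, ∑ l, T i l * a i l = - ∑ i, ∑ l, T i l * a i l := by
    conv_lhs => rw [Finset.sum_comm]
    simp only [← Finset.sum_neg_distrib]
    refine Finset.sum_congr rfl fun l _ => Finset.sum_congr rfl fun i _ => ?_
    rw [hT i l, hanti i l]
    ring
  linarith

/-- The determinant as a continuous multilinear map of the rows. -/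
def detContinuousMultilinear (n : ℕ) :
    ContinuousMultilinearMap ℝ (fun _ : Fin n => Fin n → ℝ) ℝ :=
  { (detRowAlternating (R := ℝ) (n := Fin n)).toMultilinearMap with
    cont := (continuous_id (X := Matrix (Fin n) (Fin n) ℝ)).matrix_det }

lemma detContinuousMultilinear_apply (H : Fin n → Fin n → ℝ) :
    detContinuousMultilinear n H = detRowAlternating H := rfl

lemma cofU_apply (v : E n → ℝ) (x : E n) (i j : Fin n) :
    cofU v x i j = detContinuousMultilinear n
      (Function.update (fun k l => pd2 v x k l) j (Pi.single i 1)) := by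
  rw [cofU, adjugate_apply]
  rfl

lemma contDiffOn_det_hess {Ω : Set (E n)} {v : E n → ℝ} (hΩ : IsOpen Ω)
    (hv : ContDiffOn ℝ (⊤ : ℕ∞) v Ω) :
    ContDiffOn ℝ (⊤ : ℕ∞) (fun x => (Hess v x).det) Ω := by
  have h : ContDiffOn ℝ (⊤ : ℕ∞) (fun x => (fun k l => pd2 v x k l : Fin n → Fin n → ℝ)) Ω :=
    contDiffOn_pi.2 fun k => contDiffOn_pi.2 fun l => hv.pd2_infty hΩ k l
  exact (detContinuousMultilinear n).contDiff.comp_contDiffOn h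

lemma contDiffOn_update_pd2 {Ω : Set (E n)} {v : E n → ℝ} (hΩ : IsOpen Ω)
    (hv : ContDiffOn ℝ (⊤ : ℕ∞) v Ω) (i j : Fin n) :
    ContDiffOn ℝ (⊤ : ℕ∞) (fun x => (Function.update (fun k l => pd2 v x k l) j (Pi.single i 1) :
      Fin n → Fin n → ℝ)) Ω := by
  refine contDiffOn_pi.2 fun k => ?_
  rcases eq_or_ne k j with rfl | hk
  · simpa using contDiffOn_const
  · simpa [hk] using contDiffOn_pi.2 fun l => hv.pd2_infty hΩ k l

lemma contDiffOn_cofU {Ω : Set (E n)} {v : E n → ℝ} (hΩ : IsOpen Ω)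
    (hv : ContDiffOn ℝ (⊤ : ℕ∞) v Ω) (i j : Fin n) :
    ContDiffOn ℝ (⊤ : ℕ∞) (fun x => cofU v x i j) Ω := by
  simp only [cofU_apply]
  exact (detContinuousMultilinear n).contDiff.comp_contDiffOn (contDiffOn_update_pd2 hΩ hv i j)

/-- The cofactor matrix of a Hessian is divergence free. -/
lemma sum_pd_cofU_eq_zero {Ω : Set (E n)} {v : E n → ℝ} (hΩ : IsOpen Ω)
    (hv : ContDiffOn ℝ (⊤ : ℕ∞) v Ω) {x : E n} (hx : x ∈ Ω) (j : Fin n) :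
    ∑ i, pd (fun y => cofU v y i j) x i = 0 := by
  have hpd : ∀ i, pd (fun y => cofU v y i j) x i = ∑ k, if k = j then 0 else detRowAlternating
      (Function.update (Function.update (fun k l => pd2 v x k l) j (Pi.single i (1 : ℝ))) k
        (fun l => pd (fun y => pd2 v y k l) x i)) := by
    intro i
    have hr := ((contDiffOn_update_pd2 hΩ hv i j).contDiffAt (hΩ.mem_nhds hx)).differentiableAt
      (by simp)
    have hcomp := ((detContinuousMultilinear n).hasFDerivAt
      (Function.update (fun k l => pd2 v x k l) j (Pi.single i 1))).comp x hr.hasFDerivAt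
    simp only [cofU_apply, pd]
    erw [hcomp.fderiv]
    rw [ContinuousLinearMap.comp_apply, ContinuousMultilinearMap.linearDeriv_apply]
    refine Finset.sum_congr rfl fun k _ => ?_
    have hrow : fderiv ℝ (fun y => (Function.update (fun k l => pd2 v y k l) j (Pi.single i 1) :
        Fin n → Fin n → ℝ)) x (EuclideanSpace.single i 1) k =
        fderiv ℝ (fun y => (Function.update (fun k l => pd2 v y k l) j (Pi.single i 1) :
        Fin n → Fin n → ℝ) k) x (EuclideanSpace.single i 1) := by
      rw [(hasFDerivAt_pi'.1 hr.hasFDerivAt k).fderiv]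
      rfl
    rw [hrow]
    split_ifs with hk
    · subst hk
      simp only [Function.update_self, fderiv_fun_const]
      exact MultilinearMap.map_update_zero _ _ _
    · have hd : ∀ l, DifferentiableAt ℝ (fun y => pd2 v y k l) x := fun l =>
        ((hv.pd2_infty hΩ k l).contDiffAt (hΩ.mem_nhds hx)).differentiableAt (by simp)
      simp only [Function.update_of_ne hk]
      rw [fderiv_pi hd, detContinuousMultilinear_apply]
      rfl
  simp only [hpd]
  rw [Finset.sum_comm]
  refine Finset.sum_eq_zero fun k _ => ?_
  split_ifs with hk
  · simp
  · exact sum_det_update_update_eq_zero _ (fun i l => pd (fun y => pd2 v y k l) x i)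
      (fun i l => pd_pd2_comm hΩ hv hx i k l) (Ne.symm hk)

end Cofactor

section IntegrationByParts

variable {n : ℕ}

lemma ContDiff.mul_contDiffOn {k : WithTop ℕ∞} {Ω : Set (E n)} {g h : E n → ℝ}
    (hΩ : IsOpen Ω) (hg : ContDiff ℝ k g) (hgs : tsupport g ⊆ Ω) (hh : ContDiffOn ℝ k h Ω) :
    ContDiff ℝ k (fun x => g x * h x) := by
  refine contDiff_iff_contDiffAt.2 fun x => ?_
  by_cases hx : x ∈ tsupport g
  · exact hg.contDiffAt.mul (hh.contDiffAt (hΩ.mem_nhds (hgs hx)))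
  · refine (contDiffAt_const (c := (0 : ℝ))).congr_of_eventuallyEq ?_
    filter_upwards [notMem_tsupport_iff_eventuallyEq.1 hx] with y hy
    simp [hy]

lemma integrable_mul_of_contDiffOn {Ω : Set (E n)} {g h : E n → ℝ}
    (hΩ : IsOpen Ω) (hg : Continuous g) (hgc : HasCompactSupport g) (hgs : tsupport g ⊆ Ω)
    (hh : ContinuousOn h Ω) : Integrable (fun x => g x * h x) := by
  have hcont : ContDiff ℝ 0 (fun x => g x * h x) :=
    ContDiff.mul_contDiffOn hΩ (contDiff_zero.2 hg) hgs (contDiffOn_zero.2 hh)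
  exact hcont.continuous.integrable_of_hasCompactSupport hgc.mul_right

lemma integrable_pd {f : E n → ℝ} (hf : ContDiff ℝ 1 f) (hc : HasCompactSupport f)
    (i : Fin n) : Integrable (fun x => pd f x i) :=
  ((hf.continuous_fderiv (by simp)).clm_apply continuous_const).integrable_of_hasCompactSupport
    (hc.fderiv_apply ℝ _)

lemma integral_pd_eq_zero {f : E n → ℝ} (hf : ContDiff ℝ 1 f) (hc : HasCompactSupport f)
    (i : Fin n) : ∫ x, pd f x i = 0 := by
  have h := integral_mul_fderiv_eq_neg_fderiv_mul_of_integrable (μ := volume)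
    (f := fun _ : E n => (1 : ℝ)) (g := f) (v := EuclideanSpace.single i (1 : ℝ)) (by simp)
    (by simpa [pd] using integrable_pd hf hc i)
    (by simpa using hf.continuous.integrable_of_hasCompactSupport hc)
    (fun x _ => differentiableAt_const _) (fun x _ => hf.differentiable (by simp) x)
  simpa [pd] using h

lemma sum_cofU_mul_pd2 {v : E n → ℝ} {x : E n} (hv : ContDiffAt ℝ 2 v x) :
    ∑ i, ∑ j, cofU v x i j * pd2 v x i j = n * (Hess v x).det := by
  have h := congrArg Matrix.trace (Matrix.adjugate_mul (Hess v x))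
  rw [Matrix.trace_smul, Matrix.trace_one, Fintype.card_fin, smul_eq_mul, mul_comm] at h
  rw [← h, Matrix.trace]
  simp only [Matrix.diag, Matrix.mul_apply, cofU]
  refine Finset.sum_congr rfl fun i _ => Finset.sum_congr rfl fun j _ => ?_
  rw [pd2_comm hv i j]
  rfl

/-- Integration by parts for the linearized Monge-Ampère operator. -/
lemma integral_cofU_pd_pd {Ω : Set (E n)} {v g : E n → ℝ} (hΩ : IsOpen Ω)
    (hv : ContDiffOn ℝ (⊤ : ℕ∞) v Ω) (hg : ContDiff ℝ 1 g) (hgc : HasCompactSupport g)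
    (hgs : tsupport g ⊆ Ω) :
    ∫ x, ∑ i, ∑ j, cofU v x i j * pd g x i * pd v x j =
      - (n * ∫ x, g x * (Hess v x).det) := by
  set R : Fin n → E n → ℝ := fun i x => ∑ j, cofU v x i j * pd v x j with hR
  have hRs : ∀ i, ContDiffOn ℝ (⊤ : ℕ∞) (R i) Ω := fun i =>
    ContDiffOn.sum fun j _ => (contDiffOn_cofU hΩ hv i j).mul (hv.pd_infty hΩ j)
  have hF : ∀ i, ContDiff ℝ 1 (fun x => g x * R i x) := fun i =>
    ContDiff.mul_contDiffOn hΩ hg hgs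
      ((hRs i).of_le (by exact_mod_cast (le_top : (1 : ℕ∞) ≤ ⊤)))
  have hzero : ∫ x, ∑ i, pd (fun y => g y * R i y) x i = 0 := by
    rw [integral_finsetSum _ fun i _ => integrable_pd (hF i) hgc.mul_right i]
    exact Finset.sum_eq_zero fun i _ => integral_pd_eq_zero (hF i) hgc.mul_right i
  have hpoint : ∀ x, ∑ i, ∑ j, cofU v x i j * pd g x i * pd v x j =
      ∑ i, pd (fun y => g y * R i y) x i - n * (g x * (Hess v x).det) := by
    intro x
    by_cases hx : x ∈ tsupport g
    · have hxΩ := hΩ.mem_nhds (hgs hx)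
      have hdc : ∀ i j, DifferentiableAt ℝ (fun y => cofU v y i j) x := fun i j =>
        ((contDiffOn_cofU hΩ hv i j).contDiffAt hxΩ).differentiableAt (by simp)
      have hdp : ∀ j, DifferentiableAt ℝ (fun y => pd v y j) x := fun j =>
        ((hv.pd_infty hΩ j).contDiffAt hxΩ).differentiableAt (by simp)
      have hpdR : ∀ i, pd (R i) x i =
          ∑ j, (cofU v x i j * pd2 v x i j + pd v x j * pd (fun y => cofU v y i j) x i) := by
        intro i
        change fderiv ℝ (fun y => ∑ j, cofU v y i j * pd v y j) x (EuclideanSpace.single i 1) = _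
        rw [fderiv_fun_sum fun j _ => (hdc i j).fun_mul (hdp j)]
        rw [_root_.sum_apply]
        refine Finset.sum_congr rfl fun j _ => ?_
        rw [fderiv_fun_mul (hdc i j) (hdp j)]
        rfl
      have hpdF : ∀ i, pd (fun y => g y * R i y) x i = g x * pd (R i) x i + R i x * pd g x i := by
        intro i
        have hd := ((hRs i).contDiffAt hxΩ).differentiableAt (by simp)
        simp only [pd]
        rw [fderiv_fun_mul (hg.differentiable (by simp) x) hd]
        rfl
      have hdiv : ∑ i, ∑ j, pd v x j * pd (fun y => cofU v y i j) x i = 0 := by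
        rw [Finset.sum_comm]
        refine Finset.sum_eq_zero fun j _ => ?_
        rw [← Finset.mul_sum, sum_pd_cofU_eq_zero hΩ hv (hgs hx), mul_zero]
      have htr := sum_cofU_mul_pd2 ((hv.contDiffAt hxΩ).of_le
        (by exact_mod_cast ENat.LEInfty.out))
      have hl : ∀ i, ∑ j, cofU v x i j * pd g x i * pd v x j = R i x * pd g x i := fun i => by
        rw [hR, Finset.sum_mul]
        exact Finset.sum_congr rfl fun j _ => by ring
      simp only [hl, hpdF, Finset.sum_add_distrib, ← Finset.mul_sum, hpdR, hdiv, htr]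
      ring
    · have hg0 : g x = 0 := image_eq_zero_of_notMem_tsupport hx
      have hev : g =ᶠ[nhds x] fun _ => 0 := notMem_tsupport_iff_eventuallyEq.1 hx
      have h1 : ∀ i, pd g x i = 0 := fun i => by
        rw [pd_congr hev]; simp [pd]
      have h2 : ∀ i, pd (fun y => g y * R i y) x i = 0 := fun i => by
        rw [pd_congr (g := fun _ => 0) (by filter_upwards [hev] with y hy; simp [hy])]
        simp [pd]
      simp [hg0, h1, h2]
  have hint : Integrable fun x => n * (g x * (Hess v x).det) :=
    (integrable_mul_of_contDiffOn hΩ hg.continuous hgc hgs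
      (contDiffOn_det_hess hΩ hv).continuousOn).const_mul _
  simp only [hpoint]
  rw [integral_sub (integrable_finsetSum _ fun i _ => integrable_pd (hF i) hgc.mul_right i) hint,
    hzero, integral_const_mul, zero_sub]

end IntegrationByParts

section Convexity

variable {n : ℕ}

open Matrix

lemma fderiv_eq_sum_pd (f : E n → ℝ) (x ξ : E n) : fderiv ℝ f x ξ = ∑ i, ξ i * pd f x i := by
  conv_lhs => rw [← (EuclideanSpace.basisFun (Fin n) ℝ).sum_repr ξ]
  simp [pd]

lemma ConvexOn.fderiv_fderiv_nonneg {Ω : Set (E n)} {u : E n → ℝ} (hΩ : IsOpen Ω)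
    (hu : ContDiffOn ℝ (⊤ : ℕ∞) u Ω) (hc : ConvexOn ℝ (closure Ω) u) {x : E n} (hx : x ∈ Ω)
    (ξ : E n) : 0 ≤ fderiv ℝ (fun y => fderiv ℝ u y ξ) x ξ := by
  obtain ⟨r, hr, hball⟩ := Metric.isOpen_iff.1 hΩ x hx
  let A : ℝ →ᵃ[ℝ] E n := AffineMap.lineMap x (x + ξ)
  have hA : ∀ s, A s = x + s • ξ := fun s => by
    simp [A, AffineMap.lineMap_apply, add_comm]
  have hAd : ∀ s, HasDerivAt A ξ s := fun s => by
    have h := ((hasDerivAt_id s).smul_const ξ).const_add x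
    simp only [one_smul] at h
    exact h.congr_of_eventuallyEq (Filter.Eventually.of_forall hA)
  set I : Set ℝ := A ⁻¹' Metric.ball x r with hI
  have hIo : IsOpen I := Metric.isOpen_ball.preimage
    (continuous_iff_continuousAt.2 fun s => (hAd s).continuousAt)
  have h0I : (0 : ℝ) ∈ I := by simp [hI, hA, hr]
  have hconv : ConvexOn ℝ I (u ∘ A) :=
    (hc.subset (hball.trans subset_closure) (convex_ball x r)).comp_affineMap A
  have hd : ∀ s ∈ I, HasDerivAt (u ∘ A) (fderiv ℝ u (A s) ξ) s := fun s hs =>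
    (((hu.contDiffAt (hΩ.mem_nhds (hball hs))).differentiableAt
      (by simp)).hasFDerivAt).comp_hasDerivAt s (hAd s)
  have hmono : MonotoneOn (fun s => fderiv ℝ u (A s) ξ) I := by
    refine (hconv.monotoneOn_deriv fun s hs => (hd s hs).differentiableAt).congr ?_
    intro s hs
    exact (hd s hs).deriv
  have hdiff : DifferentiableAt ℝ (fun y => fderiv ℝ u y ξ) (A 0) := by
    have h : ContDiffOn ℝ (⊤ : ℕ∞) (fun y => fderiv ℝ u y ξ) Ω :=
      (hu.fderiv_of_isOpen hΩ (by simp)).clm_apply contDiffOn_const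
    rw [hA, zero_smul, add_zero]
    exact (h.contDiffAt (hΩ.mem_nhds hx)).differentiableAt (by simp)
  have hd2 := hdiff.hasFDerivAt.comp_hasDerivAt 0 (hAd 0)
  have hnn := hmono.derivWithin_nonneg (x := 0)
  rw [derivWithin_of_isOpen hIo h0I] at hnn
  have he : deriv (fun s => fderiv ℝ u (A s) ξ) 0 = fderiv ℝ (fun y => fderiv ℝ u y ξ) (A 0) ξ :=
    hd2.deriv
  rw [he, hA, zero_smul, add_zero] at hnn
  exact hnn

lemma posSemidef_hess {Ω : Set (E n)} {u : E n → ℝ} (hΩ : IsOpen Ω)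
    (hu : ContDiffOn ℝ (⊤ : ℕ∞) u Ω) (hc : ConvexOn ℝ (closure Ω) u) {x : E n} (hx : x ∈ Ω) :
    (Hess u x).PosSemidef := by
  have hx2 : ContDiffAt ℝ 2 u x := (hu.contDiffAt (hΩ.mem_nhds hx)).of_le
    (by exact_mod_cast ENat.LEInfty.out)
  refine PosSemidef.of_dotProduct_mulVec_nonneg ?_ fun ξ => ?_
  · ext i j
    simpa [Hess] using pd2_comm hx2 j i
  · have h := hc.fderiv_fderiv_nonneg hΩ hu hx (WithLp.toLp 2 ξ)
    have hd : DifferentiableAt ℝ (fderiv ℝ u) x :=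
      (hx2.fderiv_right (m := 1) (by norm_num)).differentiableAt (by simp)
    have hpd : ∀ j, DifferentiableAt ℝ (fun y => pd u y j) x := fun j =>
      hd.clm_apply (differentiableAt_const _)
    rw [fderiv_eq_sum_pd] at h
    refine h.trans_eq ?_
    simp only [dotProduct, mulVec, Hess]
    refine Finset.sum_congr rfl fun i _ => ?_
    have e : pd (fun y => fderiv ℝ u y (WithLp.toLp 2 ξ)) x i = ∑ j, pd2 u x i j * ξ j := by
      have hf : (fun y => fderiv ℝ u y (WithLp.toLp 2 ξ)) = fun y => ∑ j, ξ j * pd u y j :=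
        funext fun y => fderiv_eq_sum_pd u y _
      rw [hf, pd, fderiv_fun_sum fun j _ => (differentiableAt_const _).fun_mul (hpd j),
        _root_.sum_apply]
      refine Finset.sum_congr rfl fun j _ => ?_
      rw [fderiv_const_mul (hpd j), mul_comm]
      rfl
    rw [e]
    simp

end Convexity

section Sections

variable {n : ℕ}

lemma ConvexOn.fderiv_le_sub {Ω : Set (E n)} {u : E n → ℝ} (hc : ConvexOn ℝ (closure Ω) u)
    {x₀ x : E n} (hx₀ : x₀ ∈ Ω) (hd : DifferentiableAt ℝ u x₀) (hx : x ∈ closure Ω) :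
    u x₀ + fderiv ℝ u x₀ (x - x₀) ≤ u x := by
  let A : ℝ →ᵃ[ℝ] E n := AffineMap.lineMap x₀ x
  have hA0 : A 0 = x₀ := AffineMap.lineMap_apply_zero _ _
  have hA1 : A 1 = x := AffineMap.lineMap_apply_one _ _
  have hAd : HasDerivAt A (x - x₀) 0 := AffineMap.hasDerivAt_lineMap
  have hder : HasDerivAt (u ∘ A) (fderiv ℝ u x₀ (x - x₀)) 0 := by
    have h := hd.hasFDerivAt
    rw [← hA0] at h
    simpa [hA0] using h.comp_hasDerivAt 0 hAd
  have h := (hc.comp_affineMap A).le_slope_of_hasDerivAt (x := 0) (y := 1)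
    (by simpa [hA0] using subset_closure hx₀) (by simpa [hA1] using hx) one_pos hder
  simp only [slope_def_field, Function.comp_apply, hA0, hA1] at h
  linarith

lemma hasDerivAt_max_zero_pow (k : ℕ) (s : ℝ) :
    HasDerivAt (fun s : ℝ => max 0 s ^ (k + 2)) ((k + 2) * max 0 s ^ (k + 1)) s := by
  rcases lt_trichotomy s 0 with hs | rfl | hs
  · rw [max_eq_left hs.le, zero_pow (by lia), mul_zero]
    refine (hasDerivAt_const s (0 : ℝ)).congr_of_eventuallyEq ?_
    filter_upwards [Iio_mem_nhds hs] with y hy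
    rw [max_eq_left (le_of_lt hy), zero_pow (by lia)]
  · rw [max_self, zero_pow (by lia), mul_zero, hasDerivAt_iff_tendsto_slope]
    have hc : Filter.Tendsto (fun s : ℝ => max 0 s ^ (k + 1)) (nhdsWithin 0 {0}ᶜ) (nhds 0) := by
      have h : Continuous fun s : ℝ => max 0 s ^ (k + 1) := by fun_prop
      simpa using (h.tendsto 0).mono_left nhdsWithin_le_nhds
    refine hc.congr' ?_
    filter_upwards [self_mem_nhdsWithin] with y hy
    have hy0 : y ≠ 0 := hy
    rw [slope_def_field, max_self, zero_pow (by lia), sub_zero, sub_zero, eq_div_iff hy0]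
    rcases le_total y 0 with h | h
    · simp [max_eq_left h]
    · rw [max_eq_right h]; ring
  · rw [max_eq_right hs.le]
    have h := hasDerivAt_pow (k + 2) s
    simp only [Nat.cast_add, Nat.cast_ofNat, Nat.add_succ_sub_one] at h
    refine h.congr_of_eventuallyEq ?_
    filter_upwards [Ioi_mem_nhds hs] with y hy
    rw [max_eq_right (le_of_lt hy)]

lemma contDiff_max_zero_pow (k : ℕ) : ContDiff ℝ 1 (fun s : ℝ => max 0 s ^ (k + 2)) := by
  refine contDiff_one_iff_deriv.2
    ⟨fun s => (hasDerivAt_max_zero_pow k s).differentiableAt, ?_⟩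
  rw [funext fun s => (hasDerivAt_max_zero_pow k s).deriv]
  fun_prop

/-- The truncated power `(T - w)₊ ^ (k + 2)` on a domain, extended by zero. -/
def truncPow (Ω : Set (E n)) (w : E n → ℝ) (T : ℝ) (k : ℕ) : E n → ℝ :=
  Set.indicator {x ∈ closure Ω | w x < T} fun x => (T - w x) ^ (k + 2)

lemma truncPow_apply {Ω : Set (E n)} {w : E n → ℝ} {T : ℝ} {k : ℕ} {x : E n} (hx : x ∈ Ω) :
    truncPow Ω w T k x = max 0 (T - w x) ^ (k + 2) := by
  by_cases h : w x < T
  · have hmem : x ∈ {x ∈ closure Ω | w x < T} := ⟨subset_closure hx, h⟩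
    rw [truncPow, Set.indicator_of_mem hmem, max_eq_right (by linarith)]
  · rw [truncPow, Set.indicator_of_notMem fun h' => h h'.2, max_eq_left (by linarith),
      zero_pow (by lia)]

lemma tsupport_truncPow_subset {Ω : Set (E n)} {w : E n → ℝ} {T : ℝ} {k : ℕ} :
    tsupport (truncPow Ω w T k) ⊆ closure {x ∈ closure Ω | w x < T} :=
  closure_mono Set.support_indicator_subset

lemma truncPow_eventuallyEq {Ω : Set (E n)} {w : E n → ℝ} {T : ℝ} {k : ℕ} {x : E n}
    (hΩ : IsOpen Ω) (hx : x ∈ Ω) :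
    truncPow Ω w T k =ᶠ[nhds x] fun y => max 0 (T - w y) ^ (k + 2) := by
  filter_upwards [hΩ.mem_nhds hx] with y hy using truncPow_apply hy

lemma contDiff_truncPow {Ω : Set (E n)} {w : E n → ℝ} {T : ℝ} (k : ℕ) (hΩ : IsOpen Ω)
    (hw : ContDiffOn ℝ (⊤ : ℕ∞) w Ω) (hS : closure {x ∈ closure Ω | w x < T} ⊆ Ω) :
    ContDiff ℝ 1 (truncPow Ω w T k) := by
  refine contDiff_iff_contDiffAt.2 fun x => ?_
  by_cases hx : x ∈ tsupport (truncPow Ω w T k)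
  · have hxΩ := hS (tsupport_truncPow_subset hx)
    refine ContDiffAt.congr_of_eventuallyEq ?_ (truncPow_eventuallyEq hΩ hxΩ)
    have hw1 : ContDiffAt ℝ 1 w x :=
      (hw.contDiffAt (hΩ.mem_nhds hxΩ)).of_le (by exact_mod_cast (le_top : (1 : ℕ∞) ≤ ⊤))
    exact (contDiff_max_zero_pow k).contDiffAt.comp x (contDiffAt_const.sub hw1)
  · exact (contDiffAt_const (c := (0 : ℝ))).congr_of_eventuallyEq
      (notMem_tsupport_iff_eventuallyEq.1 hx)

lemma pd_truncPow {Ω : Set (E n)} {w : E n → ℝ} {T : ℝ} (k : ℕ) {x : E n} (hΩ : IsOpen Ω)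
    (hw : ContDiffOn ℝ (⊤ : ℕ∞) w Ω) (hx : x ∈ Ω) (i : Fin n) :
    pd (truncPow Ω w T k) x i = -((k + 2) * max 0 (T - w x) ^ (k + 1) * pd w x i) := by
  have hd := ((hw.contDiffAt (hΩ.mem_nhds hx)).differentiableAt (by simp)).hasFDerivAt
  have h := (hasDerivAt_max_zero_pow k (T - w x)).comp_hasFDerivAt x (hd.const_sub T)
  rw [pd_congr (truncPow_eventuallyEq hΩ hx), pd]
  erw [h.fderiv]
  simp [pd]

lemma pd_truncPow_eq_zero {Ω : Set (E n)} {w : E n → ℝ} {T : ℝ} (k : ℕ) {x : E n}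
    (hx : x ∉ closure {x ∈ closure Ω | w x < T}) (i : Fin n) :
    pd (truncPow Ω w T k) x i = 0 := by
  rw [pd_congr (g := fun _ => 0)
    (notMem_tsupport_iff_eventuallyEq.1 fun h => hx (tsupport_truncPow_subset h))]
  simp [pd]

lemma Hess_congr {f g : E n → ℝ} {x : E n} (h : f =ᶠ[nhds x] g) : Hess f x = Hess g x := by
  ext i j
  have h' : (fun y => pd f y j) =ᶠ[nhds x] fun y => pd g y j := by
    filter_upwards [h.eventuallyEq_nhds] with y hy using pd_congr hy j
  exact pd_congr h' i

/-- The difference of `u` and its supporting affine function at `x₀`. -/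
def tangentGap (u : E n → ℝ) (x₀ x : E n) : ℝ := u x - (u x₀ + fderiv ℝ u x₀ (x - x₀))

lemma contDiffOn_tangentGap {Ω : Set (E n)} {u : E n → ℝ}
    (hu : ContDiffOn ℝ (⊤ : ℕ∞) u Ω) (x₀ : E n) :
    ContDiffOn ℝ (⊤ : ℕ∞) (tangentGap u x₀) Ω :=
  hu.sub (contDiff_const.add ((fderiv ℝ u x₀).contDiff.comp
    (contDiff_id.sub contDiff_const))).contDiffOn

lemma Hess_tangentGap {Ω : Set (E n)} {u : E n → ℝ} (hΩ : IsOpen Ω)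
    (hu : ContDiffOn ℝ (⊤ : ℕ∞) u Ω) (x₀ : E n) {x : E n} (hx : x ∈ Ω) :
    Hess (tangentGap u x₀) x = Hess u x := by
  ext i j
  have h : (fun y => pd (tangentGap u x₀) y j) =ᶠ[nhds x]
      fun y => pd u y j - pd u x₀ j := by
    filter_upwards [hΩ.mem_nhds hx] with y hy
    have hd := ((hu.contDiffAt (hΩ.mem_nhds hy)).differentiableAt (by simp)).hasFDerivAt
    have hl := ((fderiv ℝ u x₀).hasFDerivAt.comp y ((hasFDerivAt_id y).sub_const x₀)).const_add
      (u x₀)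
    have := (hd.sub hl).fderiv
    unfold pd
    erw [this]
    simp
  change pd (fun y => pd (tangentGap u x₀) y j) x i = pd (fun y => pd u y j) x i
  rw [pd_congr h, pd, fderiv_sub_const]
  rfl

lemma MASection_eq (Ω : Set (E n)) (u : E n → ℝ) (x₀ : E n) (t : ℝ) :
    MASection Ω u x₀ t = {x ∈ closure Ω | tangentGap u x₀ x < t} := by
  ext x
  simp only [MASection, tangentGap, Set.mem_ofPred_eq, sub_lt_iff_lt_add, add_comm]

lemma convex_MASection {Ω : Set (E n)} {u : E n → ℝ} (hc : ConvexOn ℝ (closure Ω) u)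
    (x₀ : E n) (t : ℝ) : Convex ℝ (MASection Ω u x₀ t) := by
  have h : ConvexOn ℝ (closure Ω) (tangentGap u x₀) := by
    refine hc.sub ?_
    refine (concaveOn_const (u x₀ - fderiv ℝ u x₀ x₀) hc.1).add
      ((fderiv ℝ u x₀).toLinearMap.concaveOn hc.1) |>.congr fun x _ => ?_
    simp only [Pi.add_apply, ContinuousLinearMap.coe_coe, map_sub]
    ring
  rw [MASection_eq]
  exact h.convex_lt t

lemma isOpen_MASection {Ω : Set (E n)} {u : E n → ℝ} (hΩ : IsOpen Ω) (hu : ContinuousOn u Ω)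
    {x₀ : E n} {t : ℝ} (hS : MASection Ω u x₀ t ⊆ Ω) : IsOpen (MASection Ω u x₀ t) := by
  have h : MASection Ω u x₀ t = Ω ∩ tangentGap u x₀ ⁻¹' Set.Iio t := by
    rw [MASection_eq] at hS ⊢
    ext x
    exact ⟨fun h => ⟨hS h, h.2⟩, fun h => ⟨subset_closure h.1, h.2⟩⟩
  rw [h]
  refine ContinuousOn.isOpen_inter_preimage ?_ hΩ isOpen_Iio
  exact hu.sub (by fun_prop)

lemma dilateCM_subset {S : Set (E n)} (hS : Convex ℝ S) (hSo : IsOpen S) (hSn : S.Nonempty)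
    (hSb : Bornology.IsBounded S) {α : ℝ} (h0 : 0 < α) (h1 : α < 1) : dilateCM α S ⊆ S := by
  have hint : IntegrableOn (fun x : E n => x) S :=
    (continuous_id.continuousOn.integrableOn_compact hSb.isCompact_closure).mono_set
      subset_closure
  have hc : centerOfMass S ∈ closure S := by
    have h := hS.set_average_mem_closure (μ := volume) (t := S) (f := fun x => x)
      (hSo.measure_pos volume hSn).ne' hSb.measure_lt_top.ne
      (ae_restrict_mem hSo.measurableSet) hint
    rwa [setAverage_eq] at h
  rintro _ ⟨x, hx, rfl⟩
  have h := hS.combo_closure_interior_mem_interior hc (by rwa [hSo.interior_eq] : x ∈ interior S)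
    (sub_nonneg.2 h1.le) h0 (by ring)
  rw [hSo.interior_eq] at h
  convert h using 1
  module

end Sections

section Capacity

variable {n : ℕ}

lemma capacity_le {u : E n → ℝ} {K V : Set (E n)} {Φ : E n → ℝ} {B : ℝ} (hB : 0 ≤ B)
    (hL : ∃ L : NNReal, LipschitzWith L Φ) (hc : HasCompactSupport Φ) (hV : tsupport Φ ⊆ V)
    (hK : ∀ x ∈ K, 1 ≤ Φ x)
    (hΦ : ∫ x in V, ∑ i, ∑ j, cofU u x i j * pd Φ x i * pd Φ x j ≤ B) :
    capacity u K V ≤ B := by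
  unfold capacity
  by_cases hb : BddBelow { e : ℝ | ∃ Φ : E n → ℝ, (∃ L : NNReal, LipschitzWith L Φ) ∧
    HasCompactSupport Φ ∧ tsupport Φ ⊆ V ∧ (∀ x ∈ K, 1 ≤ Φ x) ∧
    e = ∫ x in V, ∑ i, ∑ j, cofU u x i j * pd Φ x i * pd Φ x j }
  · exact (csInf_le hb ⟨Φ, hL, hc, hV, hK, rfl⟩).trans hΦ
  · rwa [Real.sInf_of_not_bddBelow hb]

/-- The energy identity for the truncated square of the height function of a section. -/
lemma integral_energy_truncPow {Ω V : Set (E n)} {w : E n → ℝ} {T : ℝ} (hΩ : IsOpen Ω)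
    (hw : ContDiffOn ℝ (⊤ : ℕ∞) w Ω) (hcpt : IsCompact (closure {x ∈ closure Ω | w x < T}))
    (hSV : closure {x ∈ closure Ω | w x < T} ⊆ V) (hVΩ : V ⊆ Ω) :
    ∫ x in V, ∑ i, ∑ j, cofU w x i j * pd (truncPow Ω w T 0) x i * pd (truncPow Ω w T 0) x j =
      4 / 3 * (n * ∫ x, truncPow Ω w T 1 x * (Hess w x).det) := by
  have hSΩ := hSV.trans hVΩ
  have hpoint : ∀ x, ∑ i, ∑ j,
      cofU w x i j * pd (truncPow Ω w T 0) x i * pd (truncPow Ω w T 0) x j =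
      -(4 / 3) * ∑ i, ∑ j, cofU w x i j * pd (truncPow Ω w T 1) x i * pd w x j := by
    intro x
    simp only [Finset.mul_sum]
    refine Finset.sum_congr rfl fun i _ => Finset.sum_congr rfl fun j _ => ?_
    by_cases hx : x ∈ Ω
    · simp only [pd_truncPow _ hΩ hw hx]
      push_cast
      ring
    · have hx' := fun h => hx (hSΩ h)
      simp [pd_truncPow_eq_zero _ hx']
  rw [setIntegral_eq_integral_of_forall_compl_eq_zero fun x hx => by
    simp [pd_truncPow_eq_zero 0 fun h => hx (hSV h)]]
  simp only [hpoint]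
  rw [integral_const_mul, integral_cofU_pd_pd hΩ hw (contDiff_truncPow 1 hΩ hw hSΩ)
    (hcpt.of_isClosed_subset (isClosed_tsupport _) tsupport_truncPow_subset)
    (tsupport_truncPow_subset.trans hSΩ)]
  ring

/-- Capacity estimate in terms of the measure of the doubled section. -/
lemma capacity_le_maMeasure_two_mul {Ω V : Set (E n)} {u : E n → ℝ} (hΩ : IsOpen Ω)
    (hu : ContDiffOn ℝ (⊤ : ℕ∞) u Ω) (hc : ConvexOn ℝ (closure Ω) u) (hVΩ : V ⊆ Ω)
    {x₀ : E n} (hx₀ : x₀ ∈ V) {t : ℝ} (ht : 0 < t) (hS : CptIn (MASection Ω u x₀ (2 * t)) V) :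
    capacity u (closure (MASection Ω u x₀ t)) V ≤
      32 / 3 * n * maMeasure u (MASection Ω u x₀ (2 * t)) * t⁻¹ := by
  have hx₀Ω := hVΩ hx₀
  obtain ⟨hcpt, hSV⟩ := hS
  have hSΩ := hSV.trans hVΩ
  have hSo : IsOpen (MASection Ω u x₀ (2 * t)) :=
    isOpen_MASection hΩ hu.continuousOn (subset_closure.trans hSΩ)
  have hdet : ∀ x ∈ Ω, 0 ≤ (Hess u x).det := fun x hx =>
    (posSemidef_hess hΩ hu hc hx).det_nonneg
  have hμ : 0 ≤ maMeasure u (MASection Ω u x₀ (2 * t)) :=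
    setIntegral_nonneg hSo.measurableSet fun x hx => hdet x (hSΩ (subset_closure hx))
  have hint : IntegrableOn (fun x => (Hess u x).det) (MASection Ω u x₀ (2 * t)) :=
    (((contDiffOn_det_hess hΩ hu).continuousOn.mono hSΩ).integrableOn_compact hcpt).mono_set
      subset_closure
  have hd₀ : DifferentiableAt ℝ u x₀ :=
    (hu.contDiffAt (hΩ.mem_nhds hx₀Ω)).differentiableAt (by simp)
  set w := tangentGap u x₀ with hw_def
  have hw : ContDiffOn ℝ (⊤ : ℕ∞) w Ω := contDiffOn_tangentGap hu x₀
  have hw0 : ∀ x ∈ Ω, 0 ≤ w x := fun x hx =>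
    sub_nonneg.2 (hc.fderiv_le_sub hx₀Ω hd₀ (subset_closure hx))
  have hHess : ∀ x ∈ Ω, Hess w x = Hess u x := fun x hx => Hess_tangentGap hΩ hu x₀ hx
  have hSt : closure (MASection Ω u x₀ t) ⊆ closure (MASection Ω u x₀ (2 * t)) := by
    refine closure_mono fun x hx => ⟨hx.1, hx.2.trans ?_⟩
    linarith
  have hcl : ∀ x ∈ closure (MASection Ω u x₀ t), w x ≤ t := by
    intro x hx
    have hcw : ContinuousWithinAt w (MASection Ω u x₀ t) x :=
      (hw.continuousOn.continuousAt (hΩ.mem_nhds (hSΩ (hSt hx)))).continuousWithinAt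
    refine hcw.closure_le hx continuousWithinAt_const fun y hy => ?_
    rw [MASection_eq] at hy
    exact hy.2.le
  rw [MASection_eq Ω u x₀ (2 * t)] at hSo hμ hint hcpt hSV hSΩ hSt ⊢
  set S := {x ∈ closure Ω | w x < 2 * t} with hS_def
  have hbound : ∫ x, truncPow Ω w (2 * t) 1 x * (Hess w x).det ≤ (2 * t) ^ 3 * maMeasure u S := by
    rw [← setIntegral_eq_integral_of_forall_compl_eq_zero (s := S) fun x hx => by
      rw [truncPow, Set.indicator_of_notMem hx, zero_mul], maMeasure, ← integral_const_mul]
    have hI : Integrable fun x => truncPow Ω w (2 * t) 1 x * (Hess w x).det :=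
      integrable_mul_of_contDiffOn hΩ (contDiff_truncPow 1 hΩ hw hSΩ).continuous
        (hcpt.of_isClosed_subset (isClosed_tsupport _) tsupport_truncPow_subset)
        (tsupport_truncPow_subset.trans hSΩ) (contDiffOn_det_hess hΩ hw).continuousOn
    refine setIntegral_mono_on hI.integrableOn (hint.const_mul _) hSo.measurableSet fun x hx => ?_
    have hxΩ := hSΩ (subset_closure hx)
    rw [hHess x hxΩ, truncPow_apply hxΩ]
    refine mul_le_mul_of_nonneg_right ?_ (hdet x hxΩ)
    refine pow_le_pow_left₀ (le_max_left _ _) (max_le (by linarith) ?_) _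
    linarith [hw0 x hxΩ]
  have hψ : ContDiff ℝ 1 (truncPow Ω w (2 * t) 0) := contDiff_truncPow 0 hΩ hw hSΩ
  have hψc : HasCompactSupport (truncPow Ω w (2 * t) 0) :=
    hcpt.of_isClosed_subset (isClosed_tsupport _) tsupport_truncPow_subset
  have hΦ : ContDiff ℝ 1 fun x => (t ^ 2)⁻¹ * truncPow Ω w (2 * t) 0 x := contDiff_const.mul hψ
  have hΦc : HasCompactSupport fun x => (t ^ 2)⁻¹ * truncPow Ω w (2 * t) 0 x := hψc.mul_left
  refine capacity_le (Φ := fun x => (t ^ 2)⁻¹ * truncPow Ω w (2 * t) 0 x) (by positivity)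
    (hΦ.lipschitzWith_of_hasCompactSupport hΦc (by simp)) hΦc
    ((tsupport_mul_subset_right.trans tsupport_truncPow_subset).trans hSV) ?_ ?_
  · intro x hx
    rw [truncPow_apply (hSΩ (hSt hx)), inv_mul_eq_div,
      one_le_div (by positivity)]
    refine pow_le_pow_left₀ ht.le (le_max_of_le_right ?_) _
    linarith [hcl x hx]
  · have hpd : ∀ x i, pd (fun x => (t ^ 2)⁻¹ * truncPow Ω w (2 * t) 0 x) x i =
        (t ^ 2)⁻¹ * pd (truncPow Ω w (2 * t) 0) x i := fun x i => by
      rw [pd, fderiv_const_mul (hψ.differentiable (by simp) x)]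
      rfl
    have hcongr : ∀ x, ∑ i, ∑ j, cofU u x i j *
        pd (fun x => (t ^ 2)⁻¹ * truncPow Ω w (2 * t) 0 x) x i *
        pd (fun x => (t ^ 2)⁻¹ * truncPow Ω w (2 * t) 0 x) x j =
        (t ^ 4)⁻¹ * ∑ i, ∑ j, cofU w x i j *
          pd (truncPow Ω w (2 * t) 0) x i * pd (truncPow Ω w (2 * t) 0) x j := by
      intro x
      simp only [hpd, Finset.mul_sum]
      refine Finset.sum_congr rfl fun i _ => Finset.sum_congr rfl fun j _ => ?_
      by_cases hx : x ∈ Ω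
      · rw [cofU, cofU, hHess x hx]
        field_simp
      · have hx' := fun h => hx (hSΩ h)
        simp [pd_truncPow_eq_zero _ hx']
    simp only [hcongr]
    rw [integral_const_mul, integral_energy_truncPow hΩ hw hcpt hSV hVΩ]
    calc (t ^ 4)⁻¹ * (4 / 3 * (n * ∫ x, truncPow Ω w (2 * t) 1 x * (Hess w x).det))
        ≤ (t ^ 4)⁻¹ * (4 / 3 * (n * ((2 * t) ^ 3 * maMeasure u S))) := by gcongr
      _ = 32 / 3 * n * maMeasure u S * t⁻¹ := by field_simp; ring

end Capacity

/-- Lemma 4.3: capacity upper bound in dimensions `n ≥ 3`. -/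
theorem capacity_upper_bound_dim_ge_three (n : ℕ) (hn : 3 ≤ n) (α β : ℝ) :
    ∃ C > 0, ∀ (Ω : Set (E n)) (u : E n → ℝ),
      MASetup Ω u → DoublingCM Ω u α β →
      ∀ V : Set (E n), IsOpen V → CptIn V Ω →
      ∀ x₀ ∈ V, ∀ t : ℝ, 0 < t → CptIn (MASection Ω u x₀ (2 * t)) V →
        capacity u (closure (MASection Ω u x₀ t)) V ≤
          C * maMeasure u (MASection Ω u x₀ t) * t⁻¹ := by
  have hn0 : (0 : ℝ) < n := by exact_mod_cast (by lia : 0 < n)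
  refine ⟨32 / 3 * n * max β 1, by positivity, ?_⟩
  rintro Ω u ⟨hΩ, -, -, -, hu', hc, -⟩ ⟨hα0, hα1, hβ, hdbl⟩ V - ⟨-, hVΩ'⟩ x₀ hx₀ t ht hS
  have hu : ContDiffOn ℝ (⊤ : ℕ∞) u Ω := hu'.mono subset_closure
  have hVΩ : V ⊆ Ω := subset_closure.trans hVΩ'
  have hSΩ : closure (MASection Ω u x₀ (2 * t)) ⊆ Ω := hS.2.trans hVΩ
  have hsub : MASection Ω u x₀ t ⊆ MASection Ω u x₀ (2 * t) :=
    fun x hx => ⟨hx.1, hx.2.trans (by linarith)⟩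
  have hStΩ : closure (MASection Ω u x₀ t) ⊆ Ω := (closure_mono hsub).trans hSΩ
  have hStc : IsCompact (closure (MASection Ω u x₀ t)) :=
    hS.1.of_isClosed_subset isClosed_closure (closure_mono hsub)
  have hSto : IsOpen (MASection Ω u x₀ t) :=
    isOpen_MASection hΩ hu.continuousOn (subset_closure.trans hStΩ)
  have hx₀t : x₀ ∈ MASection Ω u x₀ t := ⟨subset_closure (hVΩ hx₀), by simpa using ht⟩
  have hdil : dilateCM α (MASection Ω u x₀ t) ⊆ MASection Ω u x₀ t :=
    dilateCM_subset (convex_MASection hc x₀ t) hSto ⟨x₀, hx₀t⟩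
      (hStc.isBounded.subset subset_closure) hα0 hα1
  have hmono : maMeasure u (dilateCM α (MASection Ω u x₀ t)) ≤
      maMeasure u (MASection Ω u x₀ t) := by
    refine setIntegral_mono_set ?_ ?_ hdil.eventuallyLE
    · exact (((contDiffOn_det_hess hΩ hu).continuousOn.mono hStΩ).integrableOn_compact
        hStc).mono_set subset_closure
    · filter_upwards [ae_restrict_mem hSto.measurableSet] with x hx
      exact (posSemidef_hess hΩ hu hc (hStΩ (subset_closure hx))).det_nonneg
  have hd := hdbl x₀ (hVΩ hx₀) (2 * t) (by positivity) ⟨hS.1, hSΩ⟩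
  rw [mul_div_cancel_left₀ t two_ne_zero] at hd
  have hd' : maMeasure u (MASection Ω u x₀ (2 * t)) ≤
      max β 1 * maMeasure u (MASection Ω u x₀ t) := by
    rw [max_eq_left hβ.le]
    exact hd.trans (mul_le_mul_of_nonneg_left hmono (by linarith))
  refine (capacity_le_maMeasure_two_mul hΩ hu hc hVΩ hx₀ ht hS).trans ?_
  rw [mul_assoc (32 / 3 * (n : ℝ)) (max β 1)]
  gcongr
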